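/- Let L ≥ 3 be an integer. For a twice continuously differentiable function h : ℝ^{L−1} → ℝ, define the differential operator (L₁ h)(x) = Σ_{i=1}^{L−1} x_i (1 − x_i) ∂²h/∂x_i²(x) − Σ_{i ≠ j, 1 ≤ i,j ≤ L−1} x_i x_j ∂²h/∂x_i∂x_j(x). For x = (x_1, …, x_{L−1}) with all x_i > 0 and S := x_1 + ⋯ + x_{L−1} < 1, define g(x) ∈ ℝ^{L−1} by g(x)_j = x_j / S for 1 ≤ j ≤ L−2 and g(x)_{L−1} = S. Then for every function f : ℝ^{L−1} → ℝ that is twice continuously differentiable on a neighborhood of g(x), the composition f ∘ g is twice differentiable at x and L₁(f ∘ g)(x) = Σ_{j=1}^{L−2} (g(x)_j (1 − g(x)_j)/S) ∂²f/∂x̃_j²(g(x)) − Σ_{j ≠ k, 1 ≤ j,k ≤ L−2} (g(x)_j g(x)_k / S) ∂²f/∂x̃_j∂x̃_k(g(x)) + (1 − S) S ∂²f/∂x̃_{L−1}²(g(x)); in particular, all mixed second-order terms between the coordinates 1, …, L−2 and the coordinate L−1 of f vanish. -/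

import Mathlib

open Finset

/-- Iterated second partial derivative `∂²h/∂x_i∂x_j` of `h : ℝⁿ → ℝ` at `x`,
in the directions of the `i`-th and `j`-th coordinate vectors. -/
noncomputable def pd2 {n : ℕ} (h : (Fin n → ℝ) → ℝ) (i j : Fin n) (x : Fin n → ℝ) : ℝ :=
  fderiv ℝ (fun y => fderiv ℝ h y (Pi.single j 1)) x (Pi.single i 1)

/-- The generator `L₁` of the neutral multi-type Wright–Fisher diffusion:
`(L₁ h)(x) = Σ_i x_i (1 - x_i) ∂²h/∂x_i² - Σ_{i ≠ j} x_i x_j ∂²h/∂x_i∂x_j`. -/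
noncomputable def WFGenerator {n : ℕ} (h : (Fin n → ℝ) → ℝ) (x : Fin n → ℝ) : ℝ :=
  (∑ i, x i * (1 - x i) * pd2 h i i x)
    - ∑ i, ∑ j ∈ Finset.univ \ {i}, x i * x j * pd2 h i j x

/-- The renormalization map `g`: for `x = (x_1, …, x_{L-1})` with `S = x_1 + ⋯ + x_{L-1}`,
`g(x)_j = x_j / S` for `j ≤ L-2` and `g(x)_{L-1} = S`. -/
noncomputable def renorm (L : ℕ) (x : Fin (L - 1) → ℝ) : Fin (L - 1) → ℝ :=
  fun j => if (j : ℕ) = L - 2 then ∑ i, x i else x j / ∑ i, x i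

theorem hasFDerivAt_quot {n : ℕ} {u v : (Fin n → ℝ) → ℝ} {u' v' : (Fin n → ℝ) →L[ℝ] ℝ}
    {y : Fin n → ℝ} (hu : HasFDerivAt u u' y) (hv : HasFDerivAt v v' y) (hy : v y ≠ 0) :
    HasFDerivAt (fun z => u z / v z) ((v y)⁻¹ • u' - (u y / v y ^ 2) • v') y := by
  have h1 : HasFDerivAt (fun z => (v z)⁻¹) _ y := (hasDerivAt_inv hy).comp_hasFDerivAt y hv
  have h2 : HasFDerivAt (fun z => u z * (v z)⁻¹) _ y := hu.mul h1
  simp only [div_eq_mul_inv]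
  refine h2.congr_fderiv ?_
  ext1 w
  simp
  ring

/-- the sum functional -/
noncomputable def sumCLM (n : ℕ) : (Fin n → ℝ) →L[ℝ] ℝ :=
  ∑ i, ContinuousLinearMap.proj i

theorem sumCLM_apply {n : ℕ} (v : Fin n → ℝ) : sumCLM n v = ∑ i, v i := by
  simp [sumCLM]

/-- abstract renormalization map -/
noncomputable def gMap {n : ℕ} (l : Fin n) (y : Fin n → ℝ) : Fin n → ℝ :=
  fun j => if j = l then sumCLM n y else y j / sumCLM n y

/-- its derivative -/
noncomputable def gDer {n : ℕ} (l : Fin n) (y : Fin n → ℝ) : (Fin n → ℝ) →L[ℝ] (Fin n → ℝ) :=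
  ContinuousLinearMap.pi fun j => if j = l then sumCLM n else
    (sumCLM n y)⁻¹ • ContinuousLinearMap.proj j - (y j / sumCLM n y ^ 2) • sumCLM n

theorem gDer_apply {n : ℕ} (l : Fin n) (y v : Fin n → ℝ) (j : Fin n) :
    gDer l y v j = if j = l then sumCLM n v else
      (sumCLM n y)⁻¹ * v j - (y j / sumCLM n y ^ 2) * sumCLM n v := by
  by_cases h : j = l <;> simp [gDer, h]

theorem gMap_hasFDerivAt {n : ℕ} (l : Fin n) (y : Fin n → ℝ) (hy : sumCLM n y ≠ 0) :
    HasFDerivAt (gMap l) (gDer l y) y := by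
  rw [hasFDerivAt_pi']
  intro j
  have hp : HasFDerivAt (fun y : Fin n → ℝ => y j)
    (ContinuousLinearMap.proj (R := ℝ) (φ := fun _ : Fin n => ℝ) j) y := hasFDerivAt_apply j y
  by_cases h : j = l
  · simp only [gMap, h, if_true]
    refine (sumCLM n).hasFDerivAt.congr_fderiv ?_
    ext v; simp [gDer]
  · simp only [gMap, h, if_false]
    refine (hasFDerivAt_quot hp (sumCLM n).hasFDerivAt hy).congr_fderiv ?_
    ext1 v
    simp [gDer, h]

theorem gMap_contDiffAt {n : ℕ} (l : Fin n) (y : Fin n → ℝ) (hy : sumCLM n y ≠ 0) :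
    ContDiffAt ℝ 2 (gMap l) y := by
  rw [contDiffAt_pi]
  intro j
  by_cases h : j = l
  · simp only [gMap, h, if_true]
    exact (sumCLM n).contDiff.contDiffAt
  · simp only [gMap, h, if_false]
    exact (contDiff_apply ℝ ℝ j).contDiffAt.div (sumCLM n).contDiff.contDiffAt hy

/-- second derivative of `gMap` -/
noncomputable def gDer2 {n : ℕ} (l : Fin n) (y v w : Fin n → ℝ) : Fin n → ℝ :=
  fun j => if j = l then 0 else
    - (w j * sumCLM n v) / sumCLM n y ^ 2 - (v j * sumCLM n w) / sumCLM n y ^ 2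
      + 2 * y j * sumCLM n v * sumCLM n w / sumCLM n y ^ 3

theorem gDer_hasFDerivAt {n : ℕ} (l : Fin n) (y w : Fin n → ℝ) (hy : sumCLM n y ≠ 0) :
    ∃ T : (Fin n → ℝ) →L[ℝ] (Fin n → ℝ),
      HasFDerivAt (fun z => gDer l z w) T y ∧ ∀ v, T v = gDer2 l y v w := by
  have key : ∀ j, ∃ T : (Fin n → ℝ) →L[ℝ] ℝ,
      HasFDerivAt (fun z => gDer l z w j) T y ∧ ∀ v, T v = gDer2 l y v w j := by
    intro j
    have hp : HasFDerivAt (fun y : Fin n → ℝ => y j)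
      (ContinuousLinearMap.proj (R := ℝ) (φ := fun _ : Fin n => ℝ) j) y := hasFDerivAt_apply j y
    have hs : HasFDerivAt (fun y => sumCLM n y) (sumCLM n) y := (sumCLM n).hasFDerivAt
    simp only [gDer_apply]
    by_cases h : j = l
    · simp only [h, if_true]
      exact ⟨0, hasFDerivAt_const _ _, fun v => by simp [gDer2]⟩
    · simp only [h, if_false]
      refine ⟨_, ((hasFDerivAt_quot (hasFDerivAt_const (w j) y) hs hy).sub
        ((hasFDerivAt_quot hp (hs.pow 2) (pow_ne_zero 2 hy)).mul_const (sumCLM n w))).congr_of_eventuallyEq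
          (Filter.Eventually.of_forall fun z => ?_), fun v => ?_⟩
      · simp [div_eq_mul_inv, mul_comm]
      · simp [gDer2, h]
        field_simp
        ring
  choose T hT hT' using key
  exact ⟨ContinuousLinearMap.pi T, hasFDerivAt_pi.2 hT, fun v => by ext j; simp [hT']⟩

theorem pd2_eq {n : ℕ} (f : (Fin n → ℝ) → ℝ) (y : Fin n → ℝ) (hf : ContDiffAt ℝ 2 f y)
    (i j : Fin n) :
    pd2 f i j y = fderiv ℝ (fderiv ℝ f) y (Pi.single i 1) (Pi.single j 1) := by
  have h1 : DifferentiableAt ℝ (fderiv ℝ f) y :=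
    (hf.fderiv_right (m := 1) (by norm_num)).differentiableAt (by norm_num)
  unfold pd2
  rw [(h1.hasFDerivAt.clm_apply (hasFDerivAt_const _ _)).fderiv]
  simp

theorem pd2_comp {n : ℕ} (l : Fin n) (f : (Fin n → ℝ) → ℝ) (x : Fin n → ℝ)
    (hx : sumCLM n x ≠ 0) (hf : ContDiffAt ℝ 2 f (gMap l x)) (i j : Fin n) :
    pd2 (f ∘ gMap l) i j x =
      fderiv ℝ (fderiv ℝ f) (gMap l x) (gDer l x (Pi.single i 1)) (gDer l x (Pi.single j 1))
      + fderiv ℝ f (gMap l x) (gDer2 l x (Pi.single i 1) (Pi.single j 1)) := by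
  have h1 : DifferentiableAt ℝ (fderiv ℝ f) (gMap l x) :=
    (hf.fderiv_right (m := 1) (by norm_num)).differentiableAt (by norm_num)
  have hg := gMap_hasFDerivAt l x hx
  obtain ⟨T, hT, hT'⟩ := gDer_hasFDerivAt l x (Pi.single j 1) hx
  have e1 : ∀ᶠ z in nhds (gMap l x), ContDiffAt ℝ 2 f z := hf.eventually (by simp)
  have e2 := hg.continuousAt.eventually e1
  have e3 : ∀ᶠ y in nhds x, sumCLM n y ≠ 0 :=
    (sumCLM n).continuous.continuousAt.eventually_ne hx
  have e4 : (fun y => fderiv ℝ (f ∘ gMap l) y (Pi.single j 1)) =ᶠ[nhds x]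
      fun y => fderiv ℝ f (gMap l y) (gDer l y (Pi.single j 1)) := by
    filter_upwards [e2, e3] with y h2 h3
    have := (h2.differentiableAt (by norm_num)).hasFDerivAt.comp y (gMap_hasFDerivAt l y h3)
    rw [this.fderiv]; rfl
  unfold pd2
  rw [e4.fderiv_eq]
  have h5 : HasFDerivAt (fun y => fderiv ℝ f (gMap l y)) _ x := h1.hasFDerivAt.comp x hg
  rw [(h5.clm_apply hT).fderiv]
  simp [hT', add_comm]

theorem bil_sum {n : ℕ} (B : (Fin n → ℝ) →L[ℝ] (Fin n → ℝ) →L[ℝ] ℝ) (s : Finset (Fin n))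
    (a b : Fin n → ℝ) (u v : Fin n → Fin n → ℝ) :
    B (∑ i ∈ s, a i • u i) (∑ j ∈ s, b j • v j)
      = ∑ i ∈ s, ∑ j ∈ s, a i * b j * B (u i) (v j) := by
  simp [map_sum, Finset.mul_sum, mul_assoc]
  rw [Finset.sum_comm]
  exact Finset.sum_congr rfl fun i _ => Finset.sum_congr rfl fun j _ => by ring

theorem diag_sum {n : ℕ} (s : Finset (Fin n)) (a : Fin n → ℝ) (c : ℝ)
    (P : Fin n → Fin n → ℝ) :
    (∑ i ∈ s, a i * (1 - a i) / c * P i i) - ∑ i ∈ s, ∑ j ∈ s \ {i}, a i * a j / c * P i j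
      = (∑ i ∈ s, a i * P i i) / c - (∑ i ∈ s, ∑ j ∈ s, a i * a j * P i j) / c := by
  rw [Finset.sum_div, Finset.sum_div, ← Finset.sum_sub_distrib, ← Finset.sum_sub_distrib]
  refine Finset.sum_congr rfl fun i hi => ?_
  rw [← Finset.sum_sdiff (Finset.singleton_subset_iff.2 hi)]
  simp only [Finset.sum_singleton, add_div, Finset.sum_div]
  have : ∑ j ∈ s \ {i}, a i * a j / c * P i j = ∑ j ∈ s \ {i}, a i * a j * P i j / c :=
    Finset.sum_congr rfl fun j _ => by ring
  rw [this]; ring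

theorem main_gMap {n : ℕ} (l : Fin n) (f : (Fin n → ℝ) → ℝ) (x : Fin n → ℝ)
    (hx : sumCLM n x ≠ 0) (hf : ContDiffAt ℝ 2 f (gMap l x)) :
    WFGenerator (f ∘ gMap l) x =
      (∑ j ∈ Finset.univ \ {l},
        (gMap l x j * (1 - gMap l x j) / (sumCLM n x)) * pd2 f j j (gMap l x))
      - (∑ j ∈ Finset.univ \ {l}, ∑ k ∈ (Finset.univ \ {l}) \ {j},
            (gMap l x j * gMap l x k / (sumCLM n x)) * pd2 f j k (gMap l x))
      + (1 - sumCLM n x) * sumCLM n x * pd2 f l l (gMap l x) := by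
  have hW := diag_sum Finset.univ x 1 (fun i j => pd2 (f ∘ gMap l) i j x)
  simp only [div_one] at hW
  unfold WFGenerator
  rw [hW, diag_sum _ (gMap l x) _ (fun i j => pd2 f i j (gMap l x))]
  simp only [pd2_comp l f x hx hf, pd2_eq f _ hf]
  generalize fderiv ℝ (fderiv ℝ f) (gMap l x) = B
  generalize fderiv ℝ f (gMap l x) = A
  simp only [mul_add, Finset.sum_add_distrib]
  set S := sumCLM n x with hSdef
  have hxs : ∑ i, x i • (Pi.single i 1 : Fin n → ℝ) = x := by
    ext j; simp [Finset.sum_apply, Pi.single_apply]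
  have hs1 : ∀ i, sumCLM n (Pi.single i 1) = 1 := by
    intro i; simp [sumCLM_apply]
  have hSx : ∑ i, x i = S := (sumCLM_apply x).symm
  -- first-order terms
  have hQ1 : ∑ i, x i * A (gDer2 l x (Pi.single i 1) (Pi.single i 1)) = 0 := by
    have : ∑ i, x i • gDer2 l x (Pi.single i 1) (Pi.single i 1) = 0 := by
      ext j
      by_cases h : j = l
      · simp [Finset.sum_apply, gDer2, h]
      · simp only [Finset.sum_apply, gDer2, h, if_false, hs1, Pi.smul_apply, smul_eq_mul,
          ← hSdef, Pi.single_apply, mul_one, Pi.zero_apply]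
        simp only [mul_add, mul_sub, Finset.sum_add_distrib, Finset.sum_sub_distrib,
          ← Finset.sum_mul, hSx]
        simp [neg_div, ite_div]
        field_simp
        ring
    have h2 := congrArg A this
    simpa [map_sum] using h2
  have hQ2 : ∑ i, ∑ j, x i * x j * A (gDer2 l x (Pi.single i 1) (Pi.single j 1)) = 0 := by
    have : ∑ i, ∑ k, (x i * x k) • gDer2 l x (Pi.single i 1) (Pi.single k 1) = 0 := by
      ext j
      by_cases h : j = l
      · simp [Finset.sum_apply, gDer2, h]
      · simp only [Finset.sum_apply, gDer2, h, if_false, hs1, Pi.smul_apply, smul_eq_mul,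
          ← hSdef, Pi.single_apply, mul_one, Pi.zero_apply]
        simp only [mul_add, mul_sub, Finset.sum_add_distrib, Finset.sum_sub_distrib,
          ← Finset.sum_mul, ← Finset.mul_sum, hSx]
        simp [neg_div, ite_div, mul_assoc, ← Finset.mul_sum, ← Finset.sum_mul, hSx]
        field_simp
        ring
    have h2 := congrArg A this
    simpa [map_sum] using h2
  have hB2 : ∑ i, ∑ j, x i * x j * B (gDer l x (Pi.single i 1)) (gDer l x (Pi.single j 1))
      = S ^ 2 * B (Pi.single l 1) (Pi.single l 1) := by
    rw [← bil_sum]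
    have : ∑ i, x i • gDer l x (Pi.single i 1) = S • (Pi.single l 1 : Fin n → ℝ) := by
      have h3 := congrArg (gDer l x) hxs
      simp only [map_sum, map_smul] at h3
      rw [h3]
      ext j
      by_cases h : j = l
      · simp [gDer_apply, h, ← hSdef]
      · simp [gDer_apply, h, ← hSdef]
        field_simp
        ring
    rw [this]; simp; ring
  set d : Fin n → Fin n → ℝ := fun i => if i = l then 0 else Pi.single i 1 with hd
  set p : Fin n → ℝ := ∑ i ∈ Finset.univ \ {l}, gMap l x i • (Pi.single i 1 : Fin n → ℝ) with hp
  have hpj : ∀ j, p j = if j = l then 0 else x j / S := by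
    intro j
    by_cases h : j = l
    · simp [hp, Finset.sum_apply, Pi.single_apply, h]
    · have : gMap l x j = x j / S := by simp [gMap, h, ← hSdef]
      rw [if_neg h, ← this, hp, Finset.sum_apply, Finset.sum_eq_single j]
      · simp
      · intro i _ hi
        simp [Ne.symm hi]
      · simp [h]
  have hG : ∀ i, gDer l x (Pi.single i 1) = S⁻¹ • d i + (Pi.single l 1 - S⁻¹ • p) := by
    intro i
    ext j
    by_cases h : j = l
    · subst h
      by_cases h' : i = j
      · simp [gDer_apply, hs1, hd, hpj, h']
      · simp [gDer_apply, hs1, hd, hpj, h', Pi.single_apply, Ne.symm h']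
    · by_cases h' : i = l
      · simp [gDer_apply, hs1, hd, hpj, h, h', ← hSdef]
        field_simp
      · simp [gDer_apply, hs1, hd, hpj, h, h', ← hSdef]
        field_simp
        try ring
  have hdp : ∑ i, x i • d i = S • p := by
    ext j
    by_cases h : j = l
    · subst h
      simp only [Finset.sum_apply, Pi.smul_apply, hpj, if_true, smul_zero]
      refine Finset.sum_eq_zero fun i _ => ?_
      by_cases h' : i = j
      · simp [hd, h']
      · simp [hd, h', Pi.single_apply, Ne.symm h']
    · simp only [Finset.sum_apply, Pi.smul_apply, hpj, h, if_false, smul_eq_mul]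
      rw [Finset.sum_eq_single j]
      · simp [hd, h]; field_simp
      · intro i _ hi
        by_cases h' : i = l
        · simp [hd, h']
        · simp [hd, h', Pi.single_apply, Ne.symm hi]
      · simp
  have hdd : ∑ i, x i * B (d i) (d i)
      = S * ∑ i ∈ Finset.univ \ {l}, gMap l x i * B (Pi.single i 1) (Pi.single i 1) := by
    rw [← Finset.sum_sdiff (Finset.subset_univ {l}), Finset.mul_sum]
    simp only [Finset.sum_singleton]
    have : B (d l) (d l) = 0 := by simp [hd]
    rw [this, mul_zero, add_zero]
    refine Finset.sum_congr rfl fun i hi => ?_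
    have hi' : i ≠ l := by simpa using hi
    simp only [hd, hi', if_false, gMap, ← hSdef]
    field_simp
  have hl : ∀ c, ∑ i, x i * B (d i) c = S * B p c := by
    intro c
    have := congrArg (fun z => B z c) hdp
    simpa [map_sum] using this
  have hr : ∀ c, ∑ i, x i * B c (d i) = S * B c p := by
    intro c
    have := congrArg (fun z => B c z) hdp
    simpa [map_sum] using this
  have hB1 : ∑ i, x i * B (gDer l x (Pi.single i 1)) (gDer l x (Pi.single i 1))
      = (∑ i ∈ Finset.univ \ {l}, gMap l x i * B (Pi.single i 1) (Pi.single i 1)) / S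
        - B p p / S + S * B (Pi.single l 1) (Pi.single l 1) := by
    set c : Fin n → ℝ := Pi.single l 1 - S⁻¹ • p with hc
    have e : ∀ i, x i * B (gDer l x (Pi.single i 1)) (gDer l x (Pi.single i 1))
        = S⁻¹ ^ 2 * (x i * B (d i) (d i)) + S⁻¹ * (x i * B (d i) c)
          + S⁻¹ * (x i * B c (d i)) + x i * B c c := by
      intro i
      rw [hG i]
      simp only [map_add, map_smul, ContinuousLinearMap.add_apply,
        ContinuousLinearMap.smul_apply, smul_eq_mul]
      ring
    simp only [e, Finset.sum_add_distrib, ← Finset.mul_sum, ← Finset.sum_mul, hSx, hl, hr, hdd]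
    simp only [hc, map_sub, map_smul, ContinuousLinearMap.sub_apply,
        ContinuousLinearMap.smul_apply, smul_eq_mul]
    field_simp
    ring
  rw [hQ1, hQ2, hB1, hB2, ← bil_sum, ← hp]
  ring

theorem WF_generator_of_renormalized_proportions (L : ℕ) (hL : 3 ≤ L)
    (x : Fin (L - 1) → ℝ) (hx : ∀ i, 0 < x i) (hS : (∑ i, x i) < 1)
    (f : (Fin (L - 1) → ℝ) → ℝ) (hf : ContDiffAt ℝ 2 f (renorm L x)) :
    ContDiffAt ℝ 2 (f ∘ renorm L) x ∧
    WFGenerator (f ∘ renorm L) x =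
      (∑ j ∈ Finset.univ \ {(⟨L - 2, by omega⟩ : Fin (L - 1))},
        (renorm L x j * (1 - renorm L x j) / (∑ i, x i)) * pd2 f j j (renorm L x))
      - (∑ j ∈ Finset.univ \ {(⟨L - 2, by omega⟩ : Fin (L - 1))},
          ∑ k ∈ (Finset.univ \ {(⟨L - 2, by omega⟩ : Fin (L - 1))}) \ {j},
            (renorm L x j * renorm L x k / (∑ i, x i)) * pd2 f j k (renorm L x))
      + (1 - (∑ i, x i)) * (∑ i, x i) *
          pd2 f (⟨L - 2, by omega⟩ : Fin (L - 1)) (⟨L - 2, by omega⟩ : Fin (L - 1))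
            (renorm L x) := by
  have hg : renorm L = gMap (⟨L - 2, by omega⟩ : Fin (L - 1)) := by
    funext y j
    simp [renorm, gMap, sumCLM_apply, Fin.ext_iff]
  have hpos : 0 < ∑ i, x i :=
    Finset.sum_pos (fun i _ => hx i) ⟨⟨L - 2, by omega⟩, Finset.mem_univ _⟩
  have hne : sumCLM (L - 1) x ≠ 0 := by rw [sumCLM_apply]; exact hpos.ne'
  rw [hg] at hf ⊢
  refine ⟨hf.comp x (gMap_contDiffAt _ x hne), ?_⟩
  rw [main_gMap _ f x hne hf, sumCLM_apply]
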